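/- Let D, D' be Dedekind domains with finitely generated class groups, and suppose 𝒫(D) and 𝒫(D') are order-isomorphic. Then Cl(D)/T(D) ≅ Cl(D')/T(D'), where T denotes the torsion subgroup. -/

import Mathlib

/-- `𝒫(D)`: ideals of `D` that are radicals of nonzero principal ideals. -/
def PrincRadSet (D : Type*) [CommRing D] : Set (Ideal D) :=
  {I : Ideal D | ∃ x : D, x ≠ 0 ∧ I = (Ideal.span {x}).radical}

section LinearRelations

variable {P V : Type*} [AddCommGroup V] [Module ℚ V]

/-- `S` is the support of a nonnegative linear relation between the vectors `v p`. -/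
def IsPosDependent (v : P → V) (S : Finset P) : Prop :=
  ∃ n : P →₀ ℚ, 0 ≤ n ∧ n.support = S ∧ Finsupp.linearCombination ℚ v n = 0

/-- The linear relations between the vectors `v p`, `p ∈ S`. -/
noncomputable def relationSpace (v : P → V) (S : Finset P) : Submodule ℚ (P →₀ ℚ) :=
  Finsupp.supported ℚ ℚ (S : Set P) ⊓ LinearMap.ker (Finsupp.linearCombination ℚ v)

lemma mem_relationSpace {v : P → V} {S : Finset P} {n : P →₀ ℚ} :
    n ∈ relationSpace v S ↔ n.support ⊆ S ∧ Finsupp.linearCombination ℚ v n = 0 := by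
  simp [relationSpace, Finsupp.mem_supported]

lemma IsPosDependent.union [DecidableEq P] {v : P → V} {S T : Finset P}
    (hS : IsPosDependent v S) (hT : IsPosDependent v T) : IsPosDependent v (S ∪ T) := by
  obtain ⟨n, hn, rfl, hn0⟩ := hS
  obtain ⟨m, hm, rfl, hm0⟩ := hT
  refine ⟨n + m, add_nonneg hn hm, ?_, by simp [hn0, hm0]⟩
  ext p
  have h1 := hn p
  have h2 := hm p
  simp only [Finsupp.coe_zero, Pi.zero_apply] at h1 h2
  simp only [Finsupp.mem_support_iff, Finsupp.add_apply, Finset.mem_union, ne_eq,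
    add_eq_zero_iff_of_nonneg h1 h2]
  tauto

lemma isPosDependent_empty (v : P → V) : IsPosDependent v ∅ := ⟨0, le_rfl, by simp, by simp⟩

instance (S : Finset P) : FiniteDimensional ℚ (Finsupp.supported ℚ ℚ (S : Set P)) :=
  Module.Finite.equiv (Finsupp.supportedEquivFinsupp (R := ℚ) (M := ℚ) (S : Set P)).symm

instance (v : P → V) (S : Finset P) : FiniteDimensional ℚ (relationSpace v S) :=
  Submodule.finiteDimensional_inf_left _ _

lemma finrank_span_add_finrank_relationSpace (v : P → V) (S : Finset P) :
    Module.finrank ℚ (Submodule.span ℚ (v '' S)) + Module.finrank ℚ (relationSpace v S)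
      = S.card := by
  have h := LinearMap.finrank_range_add_finrank_ker
    ((Finsupp.linearCombination ℚ v).domRestrict (Finsupp.supported ℚ ℚ (S : Set P)))
  rw [LinearMap.range_domRestrict, ← Finsupp.span_image_eq_map_linearCombination,
    LinearMap.ker_domRestrict, (Finsupp.supportedEquivFinsupp (R := ℚ) (M := ℚ)
      (S : Set P)).finrank_eq] at h
  rw [← Submodule.finrank_map_subtype_eq, Submodule.map_comap_subtype] at h
  rw [Module.finrank_finsupp_self, ← Nat.card_eq_fintype_card, Nat.card_coe_set_eq,
    Set.ncard_coe_finset] at h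
  exact h

lemma finrank_relationSpace_of_minimal {v : P → V} {S T : Finset P} (hS : IsPosDependent v S)
    (hT : IsPosDependent v T) (hST : S ⊂ T)
    (hmin : ∀ U, IsPosDependent v U → S ⊂ U → ¬ U ⊂ T) :
    Module.finrank ℚ (relationSpace v T) = Module.finrank ℚ (relationSpace v S) + 1 := by
  classical
  obtain ⟨c, hc, hcS, hc0⟩ := hS
  obtain ⟨a, ha, haT, ha0⟩ := hT
  have hapos : ∀ p ∈ T, 0 < a p := fun p hp =>
    lt_of_le_of_ne (ha p) (by rw [← haT, Finsupp.mem_support_iff] at hp; exact hp.symm)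
  have hcpos : ∀ p ∈ S, 0 < c p := fun p hp =>
    lt_of_le_of_ne (hc p) (by rw [← hcS, Finsupp.mem_support_iff] at hp; exact hp.symm)
  have hczero : ∀ p ∉ S, c p = 0 := fun p hp => by
    rwa [← hcS, Finsupp.notMem_support_iff] at hp
  obtain ⟨q, hqT, hqS⟩ := Finset.exists_of_ssubset hST
  have hsup : relationSpace v T = relationSpace v S ⊔ Submodule.span ℚ {a} := by
    apply le_antisymm
    · intro b hb
      rw [mem_relationSpace] at hb
      obtain ⟨hbT, hb0⟩ := hb
      obtain ⟨p₀, hp₀, hmax⟩ := (T \ S).exists_max_image (fun p => b p / a p)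
        ⟨q, by simp [hqT, hqS]⟩
      rw [Finset.mem_sdiff] at hp₀
      set t := b p₀ / a p₀ with ht
      set d := t • a - b with hd
      have hd0 : Finsupp.linearCombination ℚ v d = 0 := by simp [hd, ha0, hb0]
      have hdp₀ : d p₀ = 0 := by
        have := (hapos p₀ hp₀.1).ne'
        simp [hd, ht, this]
      have hdT : ∀ p ∉ T, d p = 0 := by
        intro p hp
        have h1 : a p = 0 := by rwa [← haT, Finsupp.notMem_support_iff] at hp
        have h2 : b p = 0 := Finsupp.notMem_support_iff.1 fun h => hp (hbT h)
        simp [hd, h1, h2]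
      have hdnn : ∀ p ∉ S, 0 ≤ d p := by
        intro p hp
        by_cases hpT : p ∈ T
        · have := hmax p (by simp [hp, hpT])
          rw [div_le_iff₀ (hapos p hpT)] at this
          simpa [hd] using this
        · exact (hdT p hpT).ge
      obtain ⟨K, hK⟩ : ∃ K : ℚ, ∀ p ∈ S, - d p / c p < K := by
        obtain ⟨K, hK⟩ := (S.image fun p => - d p / c p).exists_le
        exact ⟨K + 1, fun p hp => (hK _ (Finset.mem_image_of_mem _ hp)).trans_lt (by simp)⟩
      have hepos : ∀ p ∈ S, 0 < (d + K • c) p := fun p hp => by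
        have := hK p hp
        rw [div_lt_iff₀ (hcpos p hp)] at this
        simp only [Finsupp.add_apply, Finsupp.smul_apply, smul_eq_mul]
        linarith
      have heq : ∀ p ∉ S, (d + K • c) p = d p := fun p hp => by simp [hczero p hp]
      have hdS : d ∈ relationSpace v S := by
        rw [mem_relationSpace]
        refine ⟨fun p hp => ?_, hd0⟩
        by_contra hpS
        refine hmin (d + K • c).support ⟨_, fun p => ?_, rfl, by simp [hd0, hc0]⟩ ?_ ?_
        · by_cases h : p ∈ S
          · exact (hepos p h).le
          · rw [heq p h]; exact hdnn p h
        · refine Finset.ssubset_iff_of_subset (fun p hp => ?_) |>.2 ⟨p, ?_, hpS⟩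
          · exact Finsupp.mem_support_iff.2 (hepos p hp).ne'
          · rw [Finsupp.mem_support_iff, heq p hpS]
            exact Finsupp.mem_support_iff.1 hp
        · refine Finset.ssubset_iff_of_subset (fun p hp => ?_) |>.2 ⟨p₀, hp₀.1, ?_⟩
          · by_contra h
            rw [Finsupp.mem_support_iff, heq p fun h' => h (hST.1 h')] at hp
            exact hp (hdT p h)
          · rw [Finsupp.notMem_support_iff, heq p₀ hp₀.2, hdp₀]
      have : b = -d + t • a := by simp [hd]
      rw [this]
      exact Submodule.add_mem_sup (neg_mem hdS)
        (Submodule.smul_mem _ _ (Submodule.mem_span_singleton_self a))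
    · refine sup_le (fun n hn => ?_) ?_
      · rw [mem_relationSpace] at hn ⊢
        exact ⟨hn.1.trans hST.1, hn.2⟩
      · rw [Submodule.span_singleton_le_iff_mem, mem_relationSpace]
        exact ⟨haT.le, ha0⟩
  have hinf : relationSpace v S ⊓ Submodule.span ℚ {a} = ⊥ := by
    rw [eq_bot_iff]
    rintro n ⟨hn, hna⟩
    obtain ⟨t, rfl⟩ := Submodule.mem_span_singleton.1 hna
    have h : (t • a) q = 0 :=
      Finsupp.notMem_support_iff.1 fun h => hqS ((mem_relationSpace.1 hn).1 h)
    have ht : t = 0 := by simpa [(hapos q hqT).ne'] using h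
    simp [ht]
  have hane : a ≠ 0 := fun h => (hapos q hqT).ne' (by simp [h])
  have h := Submodule.finrank_sup_add_finrank_inf_eq (relationSpace v S) (Submodule.span ℚ {a})
  rw [← hsup, hinf, finrank_span_singleton hane] at h
  simpa using h

end LinearRelations

section SupportPosets

/-- A poset `α` antitonically identified with the positively dependent finite subsets of a family
of vectors `v`, any two of whose indices are separated by such subsets. -/
structure IsSupportPoset {α P V : Type*} [PartialOrder α] [AddCommGroup V] [Module ℚ V]
    (v : P → V) (s : α → Finset P) : Prop where
  le_iff : ∀ a b, a ≤ b ↔ s b ⊆ s a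
  exists_iff : ∀ S, (∃ a, s a = S) ↔ IsPosDependent v S
  cover : ∀ p, ∃ a, p ∈ s a
  separate : ∀ p q, p ≠ q → ∃ a, p ∈ s a ∧ q ∉ s a

namespace IsSupportPoset

variable {α β P Q V W : Type*} [PartialOrder α] [PartialOrder β] [AddCommGroup V] [Module ℚ V]
  [AddCommGroup W] [Module ℚ W] {v : P → V} {w : Q → W} {s : α → Finset P} {t : β → Finset Q}

lemma lt_iff (hs : IsSupportPoset v s) (a b : α) : a < b ↔ s b ⊂ s a := by
  rw [lt_iff_le_not_ge, hs.le_iff, hs.le_iff, Finset.ssubset_def]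

lemma isPosDependent (hs : IsSupportPoset v s) (a : α) : IsPosDependent v (s a) :=
  (hs.exists_iff _).1 ⟨a, rfl⟩

lemma exists_biUnion [DecidableEq P] (hs : IsSupportPoset v s) {ι : Type*} (F : Finset ι)
    (f : ι → α) : ∃ a, s a = F.biUnion fun i => s (f i) := by
  classical
  induction F using Finset.induction_on with
  | empty => simpa using (hs.exists_iff ∅).2 (isPosDependent_empty v)
  | insert i F hi ih =>
    obtain ⟨a, ha⟩ := ih
    rw [Finset.biUnion_insert, ← ha, hs.exists_iff]
    exact (hs.isPosDependent _).union (hs.isPosDependent _)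

lemma exists_mem_imp_mem (hs : IsSupportPoset v s) (ht : IsSupportPoset w t) (e : α ≃o β) (p : P) :
    ∃ q, ∀ a, q ∈ t (e a) → p ∈ s a := by
  classical
  by_contra! h
  choose f hf hpf using h
  obtain ⟨a, ha⟩ := hs.cover p
  obtain ⟨u, hu⟩ := hs.exists_biUnion (t (e a)) f
  have hle : e u ≤ e a := by
    rw [ht.le_iff]
    intro q hq
    have : u ≤ f q := by
      rw [hs.le_iff, hu]
      exact Finset.subset_biUnion_of_mem (fun i => s (f i)) hq
    exact (ht.le_iff _ _).1 (e.monotone this) (hf q)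
  have hpu := (hs.le_iff _ _).1 (e.le_iff_le.1 hle) ha
  rw [hu, Finset.mem_biUnion] at hpu
  obtain ⟨q, -, hq⟩ := hpu
  exact hpf q hq

lemma exists_mem_iff_mem (hs : IsSupportPoset v s) (ht : IsSupportPoset w t) (e : α ≃o β) (p : P) :
    ∃ q, ∀ a, q ∈ t (e a) ↔ p ∈ s a := by
  obtain ⟨q, hq⟩ := hs.exists_mem_imp_mem ht e p
  obtain ⟨p', hp'⟩ := ht.exists_mem_imp_mem hs e.symm q
  have hp'' : ∀ a, p' ∈ s a → q ∈ t (e a) := fun a h => hp' (e a) (by simpa using h)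
  obtain rfl : p' = p := by
    by_contra hne
    obtain ⟨a, h1, h2⟩ := hs.separate _ _ hne
    exact h2 (hq a (hp'' a h1))
  exact ⟨q, fun a => ⟨hq a, hp'' a⟩⟩

lemma card_le (hs : IsSupportPoset v s) (ht : IsSupportPoset w t) (e : α ≃o β) (a : α) :
    (s a).card ≤ (t (e a)).card := by
  choose f hf using hs.exists_mem_iff_mem ht e
  refine Finset.card_le_card_of_injOn f (fun p hp => (hf p a).2 hp) fun p _ p' _ h => ?_
  by_contra hne
  obtain ⟨b, h1, h2⟩ := hs.separate _ _ hne
  rw [← hf, h, hf] at h1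
  exact h2 h1

lemma card_eq (hs : IsSupportPoset v s) (ht : IsSupportPoset w t) (e : α ≃o β) (a : α) :
    (t (e a)).card = (s a).card :=
  le_antisymm (by simpa using ht.card_le hs e.symm (e a)) (hs.card_le ht e a)

lemma finrank_relationSpace_of_covBy (hs : IsSupportPoset v s) {a b : α} (h : a ⋖ b) :
    Module.finrank ℚ (relationSpace v (s a)) = Module.finrank ℚ (relationSpace v (s b)) + 1 := by
  refine finrank_relationSpace_of_minimal (hs.isPosDependent b) (hs.isPosDependent a)
    ((hs.lt_iff _ _).1 h.lt) fun U hU hbU hUa => ?_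
  obtain ⟨c, rfl⟩ := (hs.exists_iff U).2 hU
  exact h.2 ((hs.lt_iff _ _).2 hUa) ((hs.lt_iff _ _).2 hbU)

lemma exists_covBy (hs : IsSupportPoset v s) {a : α} (h : (s a).Nonempty) : ∃ b, a ⋖ b := by
  classical
  obtain ⟨z, hz⟩ := (hs.exists_iff ∅).2 (isPosDependent_empty v)
  have hne : ((s a).ssubsets.filter (IsPosDependent v)).Nonempty :=
    ⟨∅, by simpa [isPosDependent_empty] using h⟩
  obtain ⟨B, hB, hmax⟩ := Finset.exists_max_image _ Finset.card hne
  simp only [Finset.mem_filter, Finset.mem_ssubsets] at hB hmax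
  obtain ⟨b, rfl⟩ := (hs.exists_iff B).2 hB.2
  refine ⟨b, (hs.lt_iff _ _).2 hB.1, fun c hac hcb => ?_⟩
  rw [hs.lt_iff] at hac hcb
  exact (hmax _ ⟨hac, hs.isPosDependent c⟩).not_gt (Finset.card_lt_card hcb)

lemma finrank_relationSpace_eq (hs : IsSupportPoset v s) (ht : IsSupportPoset w t) (e : α ≃o β)
    (a : α) : Module.finrank ℚ (relationSpace w (t (e a)))
      = Module.finrank ℚ (relationSpace v (s a)) := by
  induction h : (s a).card using Nat.strong_induction_on generalizing a with
  | _ n ih =>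
    subst h
    rcases (s a).eq_empty_or_nonempty with h0 | h0
    · have h1 : t (e a) = ∅ := by rw [← Finset.card_eq_zero, hs.card_eq ht e, h0, Finset.card_empty]
      have h2 := finrank_span_add_finrank_relationSpace v (s a)
      have h3 := finrank_span_add_finrank_relationSpace w (t (e a))
      rw [h0, Finset.card_empty] at h2
      rw [h1, Finset.card_empty] at h3
      rw [h0, h1]
      omega
    · obtain ⟨b, hb⟩ := hs.exists_covBy h0
      rw [hs.finrank_relationSpace_of_covBy hb,
        ht.finrank_relationSpace_of_covBy ((apply_covBy_apply_iff e).2 hb),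
        ih _ (Finset.card_lt_card ((hs.lt_iff _ _).1 hb.lt)) b rfl]

lemma exists_span_eq_top [FiniteDimensional ℚ V] (hs : IsSupportPoset v s)
    (hv : Submodule.span ℚ (Set.range v) = ⊤) :
    ∃ a, Submodule.span ℚ (v '' s a) = ⊤ := by
  classical
  obtain ⟨B, hB, hBspan⟩ := Submodule.fg_span_iff_fg_span_finset_subset (R := ℚ) (Set.range v) |>.1
    (hv ▸ Module.Finite.fg_top)
  obtain ⟨F, -, rfl⟩ := Finset.subset_set_image_iff.1 (Set.image_univ (f := v) ▸ hB)
  choose f hf using hs.cover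
  obtain ⟨a, ha⟩ := hs.exists_biUnion F f
  refine ⟨a, eq_top_iff.2 (hv.ge.trans (hBspan.le.trans (Submodule.span_mono ?_)))⟩
  rw [Finset.coe_image]
  refine Set.image_mono fun p hp => ?_
  rw [ha, Finset.coe_biUnion]
  exact Set.mem_biUnion hp (hf p)

lemma finrank_le [FiniteDimensional ℚ V] [FiniteDimensional ℚ W] (hs : IsSupportPoset v s)
    (ht : IsSupportPoset w t) (e : α ≃o β) (hv : Submodule.span ℚ (Set.range v) = ⊤) :
    Module.finrank ℚ V ≤ Module.finrank ℚ W := by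
  obtain ⟨a, ha⟩ := hs.exists_span_eq_top hv
  have h1 := finrank_span_add_finrank_relationSpace v (s a)
  have h2 := finrank_span_add_finrank_relationSpace w (t (e a))
  rw [ha, finrank_top] at h1
  rw [hs.finrank_relationSpace_eq ht, hs.card_eq ht] at h2
  have h3 := Submodule.finrank_le (Submodule.span ℚ (w '' t (e a)))
  omega

end IsSupportPoset

end SupportPosets

/-- A finitely generated commutative group modulo torsion spans a rational vector space whose
dimension is its rank. -/
lemma CommGroup.exists_hom_rat_of_fg (G : Type*) [CommGroup G] [Group.FG G] :
    ∃ (r : ℕ) (φ : Additive G →+ (Fin r → ℚ)),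
      (∀ g : G, φ (Additive.ofMul g) = 0 ↔ IsOfFinOrder g) ∧
      Submodule.span ℚ (Set.range φ) = ⊤ ∧
      Nonempty ((G ⧸ CommGroup.torsion G) ≃* Multiplicative (Fin r → ℤ)) := by
  let M := Additive (G ⧸ CommGroup.torsion G)
  let b := Module.finBasis ℤ M
  let e := b.equivFun
  let c : (Fin (Module.finrank ℤ M) → ℤ) →+ (Fin (Module.finrank ℤ M) → ℚ) :=
    (Int.castAddHom ℚ).compLeft _
  have hc : Function.Injective c := fun x y h => by
    ext i
    simpa [c] using congrFun h i
  let m : Additive G →+ M :=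
    MonoidHom.toAdditive (QuotientGroup.mk' (CommGroup.torsion G) : G →* G ⧸ CommGroup.torsion G)
  have hm : Function.Surjective m := QuotientGroup.mk_surjective (s := CommGroup.torsion G)
  refine ⟨_, c.comp (e.toLinearMap.toAddMonoidHom.comp m), fun g => ?_, ?_,
    ⟨AddEquiv.toMultiplicativeRight e.toAddEquiv⟩⟩
  · rw [← CommGroup.mem_torsion, ← QuotientGroup.eq_one_iff]
    change c (e (m (Additive.ofMul g))) = 0 ↔ _
    rw [map_eq_zero_iff c hc, map_eq_zero_iff e e.injective]
    rfl
  · rw [eq_top_iff, ← (Pi.basisFun ℚ (Fin (Module.finrank ℤ M))).span_eq, Submodule.span_le]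
    rintro _ ⟨i, rfl⟩
    obtain ⟨g, hg⟩ := hm (e.symm (Pi.single i 1))
    refine Submodule.subset_span ⟨g, ?_⟩
    change c (e (m g)) = _
    rw [hg, LinearEquiv.apply_symm_apply]
    ext j
    simp [c, Pi.single_apply]

section PrincRadSet

variable {D : Type*} [CommRing D]

lemma PrincRadSet.ne_bot {I : Ideal D} (hI : I ∈ PrincRadSet D) : I ≠ ⊥ := by
  obtain ⟨x, hx, rfl⟩ := hI
  intro h
  have := h.le (Ideal.le_radical (Ideal.mem_span_singleton_self x))
  exact hx (by simpa using this)

/-- The radical of a nonzero principal ideal, as an element of `𝒫(D)`. -/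
def PrincRadSet.mk (x : D) (hx : x ≠ 0) : PrincRadSet D := ⟨_, x, hx, rfl⟩

lemma PrincRadSet.exists_eq_mk (I : PrincRadSet D) : ∃ x hx, I = mk x hx := by
  obtain ⟨_, x, hx, rfl⟩ := I
  exact ⟨x, hx, rfl⟩

end PrincRadSet

section DedekindDomain

open IsDedekindDomain nonZeroDivisors

variable {D : Type*} [CommRing D] [IsDedekindDomain D]

/-- A nonzero prime ideal as an element of the monoid of nonzero ideals. -/
def IsDedekindDomain.HeightOneSpectrum.toNonZero (p : HeightOneSpectrum D) : (Ideal D)⁰ :=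
  ⟨p.asIdeal, mem_nonZeroDivisors_of_ne_zero p.ne_bot⟩

lemma Ideal.exists_eq_finsuppProd (I : Ideal D) (hI : I ≠ ⊥) :
    ∃ n : HeightOneSpectrum D →₀ ℕ,
      ((n.prod fun p k => p.toNonZero ^ k : (Ideal D)⁰) : Ideal D) = I := by
  induction I using UniqueFactorizationMonoid.induction_on_prime with
  | h₁ => exact absurd rfl hI
  | h₂ J hJ => exact ⟨0, by simpa using (Ideal.isUnit_iff.1 hJ).symm⟩
  | h₃ J p hJ hp ih =>
    obtain ⟨n, hn⟩ := ih hJ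
    refine ⟨n + Finsupp.single ⟨p, Ideal.isPrime_of_prime hp, hp.ne_zero⟩ 1, ?_⟩
    rw [Finsupp.prod_add_index' (by simp) (by simp [pow_add]),
      Finsupp.prod_single_index (by simp), Submonoid.coe_mul, hn, pow_one, mul_comm]
    rfl

lemma Ideal.finsuppProd_le_iff (n : HeightOneSpectrum D →₀ ℕ) (p : HeightOneSpectrum D) :
    ((n.prod fun p k => p.toNonZero ^ k : (Ideal D)⁰) : Ideal D) ≤ p.asIdeal ↔ p ∈ n.support := by
  rw [Finsupp.prod, Submonoid.coe_finsetProd, p.isPrime.prod_le]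
  constructor
  · rintro ⟨q, hq, hqp⟩
    rw [SubmonoidClass.coe_pow, Ideal.IsPrime.pow_le_iff (hP := p.isPrime) (by simpa using hq)] at hqp
    have : q = p := HeightOneSpectrum.ext (q.isMaximal.eq_of_le p.isPrime.ne_top hqp)
    exact this ▸ hq
  · intro hp
    exact ⟨p, hp, by
      rw [SubmonoidClass.coe_pow]; exact Ideal.pow_le_self (by simpa using hp)⟩

/-- The finitely many nonzero primes containing an ideal in `𝒫(D)`. -/
noncomputable def PrincRadSet.primes (I : PrincRadSet D) : Finset (HeightOneSpectrum D) :=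
  (Ideal.finite_factors (PrincRadSet.ne_bot I.2)).toFinset

lemma PrincRadSet.mem_primes {I : PrincRadSet D} {p : HeightOneSpectrum D} :
    p ∈ primes I ↔ (I : Ideal D) ≤ p.asIdeal := by
  simp [primes, Ideal.dvd_iff_le]

lemma PrincRadSet.mem_primes_mk {x : D} {hx : x ≠ 0} {p : HeightOneSpectrum D} :
    p ∈ primes (mk x hx) ↔ x ∈ p.asIdeal := by
  rw [mem_primes, mk, p.isPrime.radical_le_iff, Ideal.span_singleton_le_iff_mem]

lemma PrincRadSet.le_iff (I J : PrincRadSet D) : I ≤ J ↔ primes J ⊆ primes I := by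
  refine ⟨fun h p hp => mem_primes.2 (le_trans h (mem_primes.1 hp)), fun h => ?_⟩
  obtain ⟨y, hy, rfl⟩ := PrincRadSet.exists_eq_mk J
  change (I : Ideal D) ≤ (Ideal.span {y}).radical
  rw [Ideal.radical_eq_sInf]
  refine le_sInf fun K ⟨hyK, hK⟩ => ?_
  rw [Ideal.span_singleton_le_iff_mem] at hyK
  exact mem_primes.1 (@h ⟨K, hK, fun h0 => hy (by simpa [h0] using hyK)⟩ (mem_primes_mk.2 hyK))

/-- The image of the class of a nonzero prime under a homomorphism from the class group. -/
noncomputable def primeClass {V : Type*} [AddCommGroup V]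
    (φ : Additive (ClassGroup D) →+ V) (p : HeightOneSpectrum D) : V :=
  φ (Additive.ofMul (ClassGroup.mk0 p.toNonZero))

section

variable {V : Type*} [AddCommGroup V] [Module ℚ V]
  (φ : Additive (ClassGroup D) →+ V)

lemma linearCombination_primeClass (n : HeightOneSpectrum D →₀ ℕ) :
    Finsupp.linearCombination ℚ (primeClass φ) (n.mapRange (Nat.cast : ℕ → ℚ) Nat.cast_zero) =
      φ (Additive.ofMul (ClassGroup.mk0 (n.prod fun p k => p.toNonZero ^ k))) := by
  rw [Finsupp.linearCombination_apply, Finsupp.sum_mapRange_index (by simp), Finsupp.prod,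
    map_prod, ofMul_prod, map_sum, Finsupp.sum]
  refine Finset.sum_congr rfl fun p _ => ?_
  rw [map_pow, ofMul_pow, map_nsmul, Nat.cast_smul_eq_nsmul, primeClass]

lemma exists_nat_smul_eq_cast {P : Type*} (n : P →₀ ℚ) (hn : 0 ≤ n) :
    ∃ (k : ℕ) (m : P →₀ ℕ), k ≠ 0 ∧ m.support = n.support ∧
      m.mapRange (Nat.cast : ℕ → ℚ) Nat.cast_zero = (k : ℚ) • n := by
  let k := ∏ p ∈ n.support, (n p).den
  have hk : k ≠ 0 := Finset.prod_ne_zero_iff.2 fun p _ => (n p).den_nz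
  have key : ∀ p, ∃ a : ℕ, (a : ℚ) = k * n p := by
    intro p
    by_cases hp : p ∈ n.support
    · obtain ⟨c, hc⟩ := Finset.dvd_prod_of_mem (fun p => (n p).den) hp
      obtain ⟨z, hz⟩ := Int.eq_ofNat_of_zero_le (Rat.num_nonneg.2 (hn p))
      refine ⟨c * z, ?_⟩
      have h1 : ((n p).den : ℚ) * n p = z := by
        rw [mul_comm, Rat.mul_den_eq_num, hz]; rfl
      change _ = ((∏ p ∈ n.support, (n p).den : ℕ) : ℚ) * n p
      rw [hc]
      push_cast
      rw [← h1]
      ring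
    · exact ⟨0, by simp [Finsupp.notMem_support_iff.1 hp]⟩
  choose a ha using key
  have hsupp : ∀ p, a p ≠ 0 ↔ p ∈ n.support := fun p => by
    rw [← Nat.cast_ne_zero (R := ℚ), ha]
    simp [hk]
  refine ⟨k, Finsupp.onFinset n.support a fun p hp => (hsupp p).1 hp, hk, ?_, ?_⟩
  · ext p
    rw [Finsupp.mem_support_iff, Finsupp.onFinset_apply, hsupp]
  · ext p
    simp [ha]

lemma isPosDependent_primes (I : PrincRadSet D) :
    IsPosDependent (primeClass φ) (PrincRadSet.primes I) := by
  obtain ⟨x, hx, rfl⟩ := PrincRadSet.exists_eq_mk I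
  have hx0 : Ideal.span {x} ≠ ⊥ := by simpa using hx
  obtain ⟨n, hn⟩ := Ideal.exists_eq_finsuppProd _ hx0
  refine ⟨n.mapRange (Nat.cast : ℕ → ℚ) Nat.cast_zero, fun p => by simp, ?_, ?_⟩
  · ext p
    rw [PrincRadSet.mem_primes_mk, ← Ideal.span_singleton_le_iff_mem, ← hn,
      Ideal.finsuppProd_le_iff]
    simp
  · rw [linearCombination_primeClass,
      (ClassGroup.mk0_eq_one_iff (Subtype.prop _)).2 (hn ▸ ⟨x, rfl⟩), ofMul_one, map_zero]

lemma exists_primes_eq (hφ : ∀ g, φ (Additive.ofMul g) = 0 → IsOfFinOrder g)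
    {S : Finset (HeightOneSpectrum D)} (hS : IsPosDependent (primeClass φ) S) :
    ∃ I : PrincRadSet D, PrincRadSet.primes I = S := by
  obtain ⟨n, hn, rfl, hn0⟩ := hS
  obtain ⟨k, m, hk, hm, hmn⟩ := exists_nat_smul_eq_cast n hn
  have h0 := linearCombination_primeClass φ m
  rw [hmn, map_smul, hn0, smul_zero] at h0
  obtain ⟨l, hl, hpow⟩ := (isOfFinOrder_iff_pow_eq_one.1 (hφ _ h0.symm))
  obtain ⟨J, hJ⟩ : ∃ J : (Ideal D)⁰, J = m.prod fun p k => p.toNonZero ^ k := ⟨_, rfl⟩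
  rw [← hJ, ← map_pow] at hpow
  obtain ⟨x, hx⟩ := (ClassGroup.mk0_eq_one_iff (J ^ l).2).1 hpow
  have hx' : ((J ^ l : (Ideal D)⁰) : Ideal D) = Ideal.span {x} := hx
  have hx0 : x ≠ 0 := by
    rintro rfl
    exact nonZeroDivisors.coe_ne_zero (J ^ l) (by simpa using hx')
  refine ⟨PrincRadSet.mk x hx0, ?_⟩
  ext p
  rw [PrincRadSet.mem_primes_mk, ← Ideal.span_singleton_le_iff_mem, ← hx', SubmonoidClass.coe_pow,
    Ideal.IsPrime.pow_le_iff (hP := p.isPrime) hl.ne', hJ, Ideal.finsuppProd_le_iff, hm]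

lemma isSupportPoset_primes (hφ : ∀ g, φ (Additive.ofMul g) = 0 → IsOfFinOrder g) :
    IsSupportPoset (primeClass φ) (PrincRadSet.primes (D := D)) where
  le_iff := PrincRadSet.le_iff
  exists_iff S := ⟨by rintro ⟨I, rfl⟩; exact isPosDependent_primes φ I, exists_primes_eq φ hφ⟩
  cover p := by
    obtain ⟨x, hx, hx0⟩ := Submodule.exists_mem_ne_zero_of_ne_bot p.ne_bot
    exact ⟨PrincRadSet.mk x hx0, PrincRadSet.mem_primes_mk.2 hx⟩
  separate p q hpq := by
    have hle : ¬ p.asIdeal ≤ q.asIdeal := fun h =>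
      hpq (HeightOneSpectrum.ext (p.isMaximal.eq_of_le q.isPrime.ne_top h))
    obtain ⟨x, hx, hxq⟩ := SetLike.not_le_iff_exists.1 hle
    refine ⟨PrincRadSet.mk x fun h => hxq (by simp [h]), PrincRadSet.mem_primes_mk.2 hx, ?_⟩
    rwa [PrincRadSet.mem_primes_mk]

lemma span_range_primeClass (h : Submodule.span ℚ (Set.range φ) = ⊤) :
    Submodule.span ℚ (Set.range (primeClass φ)) = ⊤ := by
  rw [eq_top_iff, ← h, Submodule.span_le]
  rintro _ ⟨g, rfl⟩
  obtain ⟨J, hJ⟩ := ClassGroup.mk0_surjective g.toMul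
  obtain ⟨n, hn⟩ := Ideal.exists_eq_finsuppProd (J : Ideal D) (nonZeroDivisors.coe_ne_zero J)
  have hg : g = Additive.ofMul (ClassGroup.mk0 (n.prod fun p k => p.toNonZero ^ k)) := by
    rw [Subtype.ext hn, hJ, ofMul_toMul]
  rw [hg, ← linearCombination_primeClass, SetLike.mem_coe, ← Finsupp.range_linearCombination]
  exact LinearMap.mem_range_self _ _

end

end DedekindDomain

/-- If `D, D'` are Dedekind domains with finitely generated class groups and `𝒫(D)`, `𝒫(D')`
are order-isomorphic, then `Cl(D)/T(D) ≅ Cl(D')/T(D')`, where `T` denotes the torsion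
subgroup. -/
theorem classGroup_mod_torsion_iso_of_orderIso {D D' : Type*}
    [CommRing D] [IsDomain D] [IsDedekindDomain D]
    [CommRing D'] [IsDomain D'] [IsDedekindDomain D']
    (hfg : Group.FG (ClassGroup D)) (hfg' : Group.FG (ClassGroup D'))
    (ψ : (PrincRadSet D) ≃o (PrincRadSet D')) :
    Nonempty ((ClassGroup D ⧸ CommGroup.torsion (ClassGroup D)) ≃*
      (ClassGroup D' ⧸ CommGroup.torsion (ClassGroup D'))) := by
  have : Group.FG (ClassGroup D) := hfg
  have : Group.FG (ClassGroup D') := hfg'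
  obtain ⟨r, φ, hφ, hspan, ⟨e⟩⟩ := CommGroup.exists_hom_rat_of_fg (ClassGroup D)
  obtain ⟨r', φ', hφ', hspan', ⟨e'⟩⟩ := CommGroup.exists_hom_rat_of_fg (ClassGroup D')
  have hs := isSupportPoset_primes φ fun g => (hφ g).1
  have hs' := isSupportPoset_primes φ' fun g => (hφ' g).1
  have hle := hs.finrank_le hs' ψ (span_range_primeClass φ hspan)
  have hge := hs'.finrank_le hs ψ.symm (span_range_primeClass φ' hspan')
  rw [Module.finrank_fin_fun, Module.finrank_fin_fun] at hle hge
  obtain rfl := le_antisymm hle hge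
  exact ⟨e.trans e'.symm⟩
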